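/- Let n ≥ 1 and let φ be an automorphism of the free group F_n on generators x_1, …, x_n. Let A be the n×n integer matrix whose (i,j) entry is the exponent sum of the generator x_j in the word φ(x_i) (i.e., A is the matrix of the map induced by φ on the abelianization ℤ^n of F_n). If the presented group P_φ = ⟨x_1, …, x_n | φ(x_1)x_1⁻¹, …, φ(x_n)x_n⁻¹⟩ is the trivial group, then the matrix A − I is invertible over ℤ (equivalently, det(A − I) = ±1). -/

import Mathlib

/-- The exponent sum of the generator `j` in a word of the free group on `Fin n`,
i.e. the `j`-th coordinate of the image in the abelianization `ℤⁿ`. -/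
def expSum {n : ℕ} (j : Fin n) : FreeGroup (Fin n) →* Multiplicative ℤ :=
  FreeGroup.lift fun i => Multiplicative.ofAdd (if i = j then (1 : ℤ) else 0)

/-- If the presented group `⟨x₁,…,xₙ ∣ φ(xᵢ)xᵢ⁻¹⟩` associated with an automorphism `φ`
of the free group of rank `n ≥ 1` is trivial, then `A - I` is invertible over `ℤ`,
where `A` is the matrix induced by `φ` on the abelianization `ℤⁿ`. -/
theorem det_sub_one_isUnit_of_presented_trivial (n : ℕ) (hn : 1 ≤ n)
    (φ : FreeGroup (Fin n) ≃* FreeGroup (Fin n))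
    (A : Matrix (Fin n) (Fin n) ℤ)
    (hA : ∀ i j, A i j = Multiplicative.toAdd (expSum j (φ (FreeGroup.of i))))
    (htriv : Subsingleton
      (PresentedGroup (Set.range fun i : Fin n => φ (FreeGroup.of i) * (FreeGroup.of i)⁻¹))) :
    IsUnit (A - 1) := by
  classical
  let ab : FreeGroup (Fin n) →* Multiplicative (Fin n → ℤ) :=
    { toFun := fun w => Multiplicative.ofAdd (fun j => Multiplicative.toAdd (expSum j w))
      map_one' := by
        apply Multiplicative.toAdd.injective
        funext j
        simp
      map_mul' := by
        intro x y
        apply Multiplicative.toAdd.injective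
        funext j
        simp }
  have hab : ∀ w j, Multiplicative.toAdd (ab w) j = Multiplicative.toAdd (expSum j w) :=
    fun _ _ => rfl
  let S : Subgroup (Multiplicative (Fin n → ℤ)) :=
    AddSubgroup.toSubgroup (LinearMap.range (Matrix.vecMulLinear (A - 1))).toAddSubgroup
  have hS : ∀ x, x ∈ S ↔ ∃ v, Matrix.vecMul v (A - 1) = Multiplicative.toAdd x :=
    fun _ => Iff.rfl
  have hle : Subgroup.normalClosure
      (Set.range fun i : Fin n => φ (FreeGroup.of i) * (FreeGroup.of i)⁻¹) ≤ S.comap ab := by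
    apply Subgroup.normalClosure_le_normal
    rintro _ ⟨i, rfl⟩
    refine (hS (ab (φ (FreeGroup.of i) * (FreeGroup.of i)⁻¹))).2 ⟨Pi.single i 1, ?_⟩
    funext j
    rw [hab, Matrix.single_one_vecMul]
    simp [Matrix.one_apply, hA, expSum, sub_eq_add_neg]
  have key : ∀ k : Fin n, ∃ v, Matrix.vecMul v (A - 1) = Pi.single k 1 := by
    intro k
    have h1 : FreeGroup.of k ∈ S.comap ab := by
      apply hle
      rw [← QuotientGroup.eq_one_iff]
      exact htriv.elim _ _
    obtain ⟨v, hv⟩ := (hS (ab (FreeGroup.of k))).1 h1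
    refine ⟨v, hv.trans ?_⟩
    funext j
    rw [hab]
    simp [expSum, Pi.single_apply, eq_comm]
  choose B hB using key
  have hmul : (Matrix.of B) * (A - 1) = 1 := by
    ext i j
    have := congrFun (hB i) j
    simpa [Matrix.mul_apply, Matrix.vecMul, dotProduct, Matrix.one_apply, Pi.single_apply,
      eq_comm] using this
  exact IsUnit.of_mul_eq_one_right _ hmul
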